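/- Let $V$ be a real vector space endowed with an inner product, with norm $|X| = \sqrt{X\cdot X}$. Then for any real $q \ge 0$ and any $X, Y \in V$, one has the sharper bound $\left||X|^q X - |Y|^q Y\right| \le (q+1)\,\max\left(|X|^q , |Y|^q\right)|X - Y|$. -/

import Mathlib

/-- Bernoulli's inequality in homogeneous form. -/
lemma rpow_sub_rpow_mul_le {q a b : ℝ} (hq : 0 ≤ q) (hb : 0 ≤ b) (hab : b ≤ a) :
    (a ^ q - b ^ q) * b ≤ q * a ^ q * (a - b) := by
  rcases hb.eq_or_lt with rfl | hb
  · have : 0 ≤ q * a ^ q * (a - 0) := by rw [sub_zero]; positivity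
    simpa using this
  have ha : 0 < a := hb.trans_le hab
  have hbern := one_add_mul_self_le_rpow_one_add (s := b / a - 1) (p := q + 1)
    (by linarith [div_pos hb ha]) (by linarith)
  rw [add_sub_cancel, Real.rpow_add_one (div_pos hb ha).ne', Real.div_rpow hb.le ha.le] at hbern
  have haq : 0 < a ^ q := Real.rpow_pos_of_pos ha q
  have h := mul_le_mul_of_nonneg_right hbern (mul_pos haq ha).le
  have e₁ : (1 + (q + 1) * (b / a - 1)) * (a ^ q * a) = a ^ q * (a + (q + 1) * (b - a)) := by
    field_simp
  have e₂ : b ^ q / a ^ q * (b / a) * (a ^ q * a) = b ^ q * b := by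
    field_simp
  rw [e₁, e₂] at h
  linarith

lemma norm_rpow_smul_sub_le_of_norm_le {V : Type*} [NormedAddCommGroup V] [NormedSpace ℝ V]
    {q : ℝ} (hq : 0 ≤ q) {X Y : V} (hYX : ‖Y‖ ≤ ‖X‖) :
    ‖‖X‖ ^ q • X - ‖Y‖ ^ q • Y‖ ≤ (q + 1) * ‖X‖ ^ q * ‖X - Y‖ := by
  have hpow : ‖Y‖ ^ q ≤ ‖X‖ ^ q := Real.rpow_le_rpow (norm_nonneg Y) hYX hq
  calc ‖‖X‖ ^ q • X - ‖Y‖ ^ q • Y‖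
      = ‖‖X‖ ^ q • (X - Y) + (‖X‖ ^ q - ‖Y‖ ^ q) • Y‖ := by
        congr 1; module
    _ ≤ ‖X‖ ^ q * ‖X - Y‖ + (‖X‖ ^ q - ‖Y‖ ^ q) * ‖Y‖ := by
        refine (norm_add_le _ _).trans_eq ?_
        rw [norm_smul, norm_smul, Real.norm_of_nonneg (by positivity),
          Real.norm_of_nonneg (sub_nonneg.2 hpow)]
    _ ≤ ‖X‖ ^ q * ‖X - Y‖ + q * ‖X‖ ^ q * (‖X‖ - ‖Y‖) := by
        exact add_le_add le_rfl (rpow_sub_rpow_mul_le hq (norm_nonneg Y) hYX)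
    _ ≤ ‖X‖ ^ q * ‖X - Y‖ + q * ‖X‖ ^ q * ‖X - Y‖ := by
        gcongr
        exact norm_sub_norm_le X Y
    _ = (q + 1) * ‖X‖ ^ q * ‖X - Y‖ := by ring

/-- Sharper form of Lemma 2.1, inequality (2.5): for a real inner product space `V`,
any real `q ≥ 0` and any `X Y : V`, one has
`||X|^q X - |Y|^q Y| ≤ (q+1) max(|X|^q, |Y|^q) |X - Y|`. -/
theorem lipschitz_inequality_rpow_max
    {V : Type*} [NormedAddCommGroup V] [InnerProductSpace ℝ V]
    (q : ℝ) (hq : 0 ≤ q) (X Y : V) :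
    ‖‖X‖ ^ q • X - ‖Y‖ ^ q • Y‖ ≤ (q + 1) * max (‖X‖ ^ q) (‖Y‖ ^ q) * ‖X - Y‖ := by
  rcases le_total ‖Y‖ ‖X‖ with h | h
  · rw [max_eq_left (Real.rpow_le_rpow (norm_nonneg Y) h hq)]
    exact norm_rpow_smul_sub_le_of_norm_le hq h
  · rw [max_eq_right (Real.rpow_le_rpow (norm_nonneg X) h hq), norm_sub_rev, norm_sub_rev X Y]
    exact norm_rpow_smul_sub_le_of_norm_le hq h
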